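/- arXiv:2404.08115 — 2 statements merged into one kernel-verified Lean document; each statement's English description precedes it below -/
import Mathlib

section
/- Let n ≥ 2, let Ω₁ ⊂ ℝⁿ be a nonempty bounded open set and let r > 0. Let (v₁, p₁, R̊₁) and (v₂, p₂, R̊₂) be smooth subsolutions of the Euler equations on ℝⁿ × ℝ. Then there exists a smooth subsolution (v, p, R̊) of the Euler equations on ℝⁿ × ℝ such that (v, p, R̊)(x,t) = (v₁, p₁, R̊₁)(x,t) whenever x ∈ closure(Ω₁), and (v, p, R̊)(x,t) = (v₂, p₂, R̊₂)(x,t) whenever dist(x, Ω₁) ≥ r. Moreover, if in addition v₁ = Div A₁ and v₂ = Div A₂ for smooth skew-symmetric-matrix-valued maps A₁, A₂ on ℝⁿ × ℝ, then A can be chosen smooth skew-symmetric-matrix-valued with v = Div A and A(x,t) = A₂(x,t) whenever dist(x, Ω₁) ≥ r. -/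
noncomputable section
open MeasureTheory

/-- `Euc n` is Euclidean space `ℝⁿ`. -/
abbrev Euc (n : ℕ) := EuclideanSpace ℝ (Fin n)

/-- Spatial partial derivative `∂ⱼ` of a scalar function of space and time. -/
def spd {n : ℕ} (j : Fin n) (f : Euc n × ℝ → ℝ) (q : Euc n × ℝ) : ℝ :=
  fderiv ℝ (fun y => f (y, q.2)) q.1 (EuclideanSpace.single j 1)

/-- Temporal partial derivative `∂ₜ` of a scalar function of space and time. -/
def tpd {n : ℕ} (f : Euc n × ℝ → ℝ) (q : Euc n × ℝ) : ℝ :=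
  deriv (fun s => f (q.1, s)) q.2

/-- `(v, p, R̊)` is a smooth subsolution of the Euler equations on `V`:
`v, p, R̊` are smooth on `V`, `R̊` is symmetric and trace-free, and
`∂ₜ v + v·∇v + ∇p = Div R̊`, `div v = 0` hold on `V`. -/
def IsSubsolutionOn {n : ℕ} (V : Set (Euc n × ℝ)) (v : Euc n × ℝ → Fin n → ℝ)
    (p : Euc n × ℝ → ℝ) (R : Euc n × ℝ → Fin n → Fin n → ℝ) : Prop :=
  ContDiffOn ℝ (⊤ : ℕ∞) v V ∧ ContDiffOn ℝ (⊤ : ℕ∞) p V ∧ ContDiffOn ℝ (⊤ : ℕ∞) R V ∧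
  (∀ q ∈ V, ∀ i j, R q i j = R q j i) ∧
  (∀ q ∈ V, ∑ i, R q i i = 0) ∧
  (∀ q ∈ V, ∀ i, tpd (fun y => v y i) q
      + (∑ j, v q j * spd j (fun y => v y i) q) + spd i p q
      = ∑ j, spd j (fun y => R y i j) q) ∧
  (∀ q ∈ V, ∑ i, spd i (fun y => v y i) q = 0)


/-! ### Parametric integrals -/

lemma hasFDerivAt_param {H E : Type} [NormedAddCommGroup H] [NormedSpace ℝ H]
    [FiniteDimensional ℝ H] [NormedAddCommGroup E] [NormedSpace ℝ E] [CompleteSpace E]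
    (F : H × ℝ → E) (hF : ContDiff ℝ 1 F) (q : H) :
    HasFDerivAt (fun q => ∫ s in (0:ℝ)..1, F (q, s))
      (∫ s in (0:ℝ)..1, (fderiv ℝ F (q, s)).comp (ContinuousLinearMap.inl ℝ H ℝ)) q := by
  have : ProperSpace H := FiniteDimensional.proper ℝ H
  have hd : Continuous (fun z : H × ℝ =>
      (fderiv ℝ F z).comp (ContinuousLinearMap.inl ℝ H ℝ)) :=
    (hF.continuous_fderiv (by norm_num)).clm_comp continuous_const
  have hK : IsCompact (Metric.closedBall q 1 ×ˢ Set.Icc (0:ℝ) 1) :=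
    (isCompact_closedBall q 1).prod isCompact_Icc
  obtain ⟨C, hC⟩ := hK.exists_bound_of_continuousOn hd.continuousOn
  refine intervalIntegral.hasFDerivAt_integral_of_dominated_of_fderiv_le
    (F := fun q s => F (q, s))
    (F' := fun q s => (fderiv ℝ F (q, s)).comp (ContinuousLinearMap.inl ℝ H ℝ))
    (s := Metric.closedBall q 1) (bound := fun _ => C)
    (Metric.closedBall_mem_nhds q one_pos) ?_ ?_ ?_ ?_ ?_ ?_
  · refine Filter.Eventually.of_forall fun x => ?_
    exact (hF.continuous.comp (by fun_prop : Continuous fun s : ℝ => (x, s))).aestronglyMeasurable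
  · exact (hF.continuous.comp (by fun_prop : Continuous fun s : ℝ => (q, s))).intervalIntegrable _ _
  · exact (hd.comp (by fun_prop : Continuous fun s : ℝ => (q, s))).aestronglyMeasurable
  · refine Filter.Eventually.of_forall fun t ht x hx => hC (x, t) ⟨hx, ?_⟩
    rw [Set.uIoc_of_le zero_le_one] at ht
    exact Set.Ioc_subset_Icc_self ht
  · exact intervalIntegrable_const
  · refine Filter.Eventually.of_forall fun t ht x hx => ?_
    have h1 : HasFDerivAt F (fderiv ℝ F (x, t)) (x, t) :=
      ((hF.differentiable (by norm_num)) (x, t)).hasFDerivAt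
    exact HasFDerivAt.comp (f := fun x : H => (x, t)) x h1 (hasFDerivAt_prodMk_left x t)

lemma contDiff_param_nat {H : Type} [NormedAddCommGroup H] [NormedSpace ℝ H]
    [FiniteDimensional ℝ H] (m : ℕ) : ∀ {E : Type} [NormedAddCommGroup E] [NormedSpace ℝ E]
    [CompleteSpace E] (F : H × ℝ → E) (_ : ContDiff ℝ (⊤ : ℕ∞) F),
    ContDiff ℝ m (fun q => ∫ s in (0:ℝ)..1, F (q, s)) := by
  induction m with
  | zero =>
    intro E _ _ _ F hF
    have h1 : ContDiff ℝ 1 F := hF.of_le (by exact_mod_cast le_top)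
    refine contDiff_zero.2 (continuous_iff_continuousAt.2 fun q => ?_)
    exact (hasFDerivAt_param F h1 q).continuousAt
  | succ m ih =>
    intro E _ _ _ F hF
    have h1 : ContDiff ℝ 1 F := hF.of_le (by exact_mod_cast le_top)
    have h2 : ContDiff ℝ (⊤ : ℕ∞) (fun z : H × ℝ =>
      (fderiv ℝ F z).comp (ContinuousLinearMap.inl ℝ H ℝ)) :=
      (hF.fderiv_right (by exact_mod_cast le_top)).clm_comp contDiff_const
    push_cast
    refine (contDiff_succ_iff_hasFDerivAt (n := m)).2
      ⟨_, ih _ h2, fun q => hasFDerivAt_param F h1 q⟩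

lemma contDiff_param {H E : Type} [NormedAddCommGroup H] [NormedSpace ℝ H]
    [FiniteDimensional ℝ H] [NormedAddCommGroup E] [NormedSpace ℝ E] [CompleteSpace E]
    (F : H × ℝ → E) (hF : ContDiff ℝ (⊤ : ℕ∞) F) :
    ContDiff ℝ (⊤ : ℕ∞) (fun q => ∫ s in (0:ℝ)..1, F (q, s)) :=
  contDiff_infty.2 fun m => contDiff_param_nat m F hF

lemma fderiv_param {H : Type} [NormedAddCommGroup H] [NormedSpace ℝ H]
    [FiniteDimensional ℝ H] (F : H × ℝ → ℝ) (hF : ContDiff ℝ (⊤ : ℕ∞) F) (q e : H) :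
    fderiv ℝ (fun q => ∫ s in (0:ℝ)..1, F (q, s)) q e
      = ∫ s in (0:ℝ)..1, fderiv ℝ F (q, s) (e, 0) := by
  have h1 : ContDiff ℝ 1 F := hF.of_le (by exact_mod_cast le_top)
  have hd : Continuous (fun z : H × ℝ =>
      (fderiv ℝ F z).comp (ContinuousLinearMap.inl ℝ H ℝ)) :=
    (h1.continuous_fderiv (by norm_num)).clm_comp continuous_const
  rw [(hasFDerivAt_param F h1 q).fderiv, ContinuousLinearMap.intervalIntegral_apply]
  · simp
  · exact (hd.comp (by fun_prop : Continuous fun s : ℝ => (q, s))).intervalIntegrable _ _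

/-! ### Calculus of `spd` and `tpd` -/

/-- Smooth scalar functions of space and time. -/
abbrev Sm {n : ℕ} (f : Euc n × ℝ → ℝ) : Prop := ContDiff ℝ (⊤ : ℕ∞) f

/-- The `j`-th spatial direction. -/
abbrev dirS {n : ℕ} (j : Fin n) : Euc n × ℝ := (EuclideanSpace.single j 1, 0)

lemma Sm.diff {n : ℕ} {f : Euc n × ℝ → ℝ} (hf : Sm f) : Differentiable ℝ f :=
  hf.differentiable (by simp)

lemma spd_eq {n : ℕ} {f : Euc n × ℝ → ℝ} (hf : Sm f) (j : Fin n) (q : Euc n × ℝ) :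
    spd j f q = fderiv ℝ f q (dirS j) := by
  have h := HasFDerivAt.comp (f := fun x : Euc n => (x, q.2)) q.1
    (hf.diff (q.1, q.2)).hasFDerivAt (hasFDerivAt_prodMk_left q.1 q.2)
  have h' : fderiv ℝ (fun y => f (y, q.2)) q.1 = _ := h.fderiv
  rw [spd, h']; simp

lemma tpd_eq {n : ℕ} {f : Euc n × ℝ → ℝ} (hf : Sm f) (q : Euc n × ℝ) :
    tpd f q = fderiv ℝ f q (0, 1) := by
  have h := HasFDerivAt.comp (f := fun s : ℝ => (q.1, s)) q.2
    (hf.diff (q.1, q.2)).hasFDerivAt (hasFDerivAt_prodMk_right q.1 q.2)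
  have h' : deriv (fun s => f (q.1, s)) q.2 = _ := h.hasDerivAt.deriv
  rw [tpd, h']; simp

lemma spd_fun {n : ℕ} {f : Euc n × ℝ → ℝ} (hf : Sm f) (j : Fin n) :
    spd j f = fun q => fderiv ℝ f q (dirS j) := funext fun q => spd_eq hf j q

lemma tpd_fun {n : ℕ} {f : Euc n × ℝ → ℝ} (hf : Sm f) :
    tpd f = fun q => fderiv ℝ f q (0, 1) := funext fun q => tpd_eq hf q

lemma Sm.dir {n : ℕ} {f : Euc n × ℝ → ℝ} (hf : Sm f) (e : Euc n × ℝ) :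
    Sm (fun q => fderiv ℝ f q e) :=
  (hf.fderiv_right (by exact_mod_cast le_top)).clm_apply contDiff_const

lemma Sm.spd {n : ℕ} {f : Euc n × ℝ → ℝ} (hf : Sm f) (j : Fin n) : Sm (spd j f) := by
  rw [spd_fun hf]; exact hf.dir _

lemma Sm.tpd {n : ℕ} {f : Euc n × ℝ → ℝ} (hf : Sm f) : Sm (tpd f) := by
  rw [tpd_fun hf]; exact hf.dir _

lemma dir_comm {n : ℕ} {f : Euc n × ℝ → ℝ} (hf : Sm f) (a b q : Euc n × ℝ) :
    fderiv ℝ (fun q => fderiv ℝ f q a) q b = fderiv ℝ (fun q => fderiv ℝ f q b) q a := by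
  have h2 : Differentiable ℝ (fderiv ℝ f) :=
    (hf.fderiv_right (m := (⊤ : ℕ∞)) (by exact_mod_cast le_top)).differentiable (by simp)
  have hs : IsSymmSndFDerivAt ℝ f q :=
    hf.contDiffAt.isSymmSndFDerivAt (by
      rw [minSmoothness_of_isRCLikeNormedField]; exact WithTop.coe_le_coe.2 le_top)
  rw [fderiv_clm_apply (h2 q) (by fun_prop), fderiv_clm_apply (h2 q) (by fun_prop)]
  simpa using hs b a

lemma spd_comm {n : ℕ} {f : Euc n × ℝ → ℝ} (hf : Sm f) (i j : Fin n) :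
    spd i (spd j f) = spd j (spd i f) := by
  funext q
  rw [spd_eq (hf.spd j), spd_eq (hf.spd i), spd_fun hf, spd_fun hf, dir_comm hf]

lemma tpd_spd {n : ℕ} {f : Euc n × ℝ → ℝ} (hf : Sm f) (i : Fin n) :
    tpd (spd i f) = spd i (tpd f) := by
  funext q
  rw [spd_eq hf.tpd, tpd_eq (hf.spd i), spd_fun hf, tpd_fun hf, dir_comm hf]

lemma spd_add {n : ℕ} {f g : Euc n × ℝ → ℝ} (hf : Sm f) (hg : Sm g) (i : Fin n) :
    spd i (fun q => f q + g q) = fun q => spd i f q + spd i g q := by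
  funext q
  rw [spd_eq (hf.add hg), spd_eq hf, spd_eq hg, fderiv_fun_add (hf.diff q) (hg.diff q)]; rfl

lemma tpd_add {n : ℕ} {f g : Euc n × ℝ → ℝ} (hf : Sm f) (hg : Sm g) :
    tpd (fun q => f q + g q) = fun q => tpd f q + tpd g q := by
  funext q
  rw [tpd_eq (hf.add hg), tpd_eq hf, tpd_eq hg, fderiv_fun_add (hf.diff q) (hg.diff q)]; rfl

lemma spd_sub {n : ℕ} {f g : Euc n × ℝ → ℝ} (hf : Sm f) (hg : Sm g) (i : Fin n) :
    spd i (fun q => f q - g q) = fun q => spd i f q - spd i g q := by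
  funext q
  rw [spd_eq (hf.sub hg), spd_eq hf, spd_eq hg, fderiv_fun_sub (hf.diff q) (hg.diff q)]; rfl

lemma tpd_sub {n : ℕ} {f g : Euc n × ℝ → ℝ} (hf : Sm f) (hg : Sm g) :
    tpd (fun q => f q - g q) = fun q => tpd f q - tpd g q := by
  funext q
  rw [tpd_eq (hf.sub hg), tpd_eq hf, tpd_eq hg, fderiv_fun_sub (hf.diff q) (hg.diff q)]; rfl

lemma spd_mul {n : ℕ} {f g : Euc n × ℝ → ℝ} (hf : Sm f) (hg : Sm g) (i : Fin n) :
    spd i (fun q => f q * g q) = fun q => f q * spd i g q + g q * spd i f q := by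
  funext q
  rw [spd_eq (hf.mul hg), spd_eq hf, spd_eq hg, fderiv_fun_mul (hf.diff q) (hg.diff q)]; rfl

lemma tpd_mul {n : ℕ} {f g : Euc n × ℝ → ℝ} (hf : Sm f) (hg : Sm g) :
    tpd (fun q => f q * g q) = fun q => f q * tpd g q + g q * tpd f q := by
  funext q
  rw [tpd_eq (hf.mul hg), tpd_eq hf, tpd_eq hg, fderiv_fun_mul (hf.diff q) (hg.diff q)]; rfl

lemma spd_cmul {n : ℕ} {f : Euc n × ℝ → ℝ} (hf : Sm f) (c : ℝ) (i : Fin n) :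
    spd i (fun q => c * f q) = fun q => c * spd i f q := by
  funext q
  rw [spd_eq (contDiff_const.mul hf), spd_eq hf, fderiv_const_mul (hf.diff q)]; rfl

lemma tpd_cmul {n : ℕ} {f : Euc n × ℝ → ℝ} (hf : Sm f) (c : ℝ) :
    tpd (fun q => c * f q) = fun q => c * tpd f q := by
  funext q
  rw [tpd_eq (contDiff_const.mul hf), tpd_eq hf, fderiv_const_mul (hf.diff q)]; rfl

lemma spd_sum {n : ℕ} {ι : Type} {s : Finset ι} {f : ι → Euc n × ℝ → ℝ} (hf : ∀ k, Sm (f k)) (i : Fin n) :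
    spd i (fun q => ∑ k ∈ s, f k q) = fun q => ∑ k ∈ s, spd i (f k) q := by
  funext q
  rw [spd_eq (ContDiff.sum fun k _ => hf k), fderiv_fun_sum (fun k _ => (hf k).diff q)]
  simp only [sum_apply, spd_eq (hf _)]

lemma tpd_sum {n : ℕ} {ι : Type} {s : Finset ι} {f : ι → Euc n × ℝ → ℝ} (hf : ∀ k, Sm (f k)) :
    tpd (fun q => ∑ k ∈ s, f k q) = fun q => ∑ k ∈ s, tpd (f k) q := by
  funext q
  rw [tpd_eq (ContDiff.sum fun k _ => hf k), fderiv_fun_sum (fun k _ => (hf k).diff q)]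
  simp only [sum_apply, tpd_eq (hf _)]

/-- Locality of the spatial derivative. -/
lemma spd_congr {n : ℕ} {U : Set (Euc n)} (hU : IsOpen U) {f g : Euc n × ℝ → ℝ}
    (h : ∀ x ∈ U, ∀ t, f (x, t) = g (x, t)) (j : Fin n) :
    ∀ x ∈ U, ∀ t, spd j f (x, t) = spd j g (x, t) := by
  intro x hx t
  have : (fun y => f (y, t)) =ᶠ[nhds x] (fun y => g (y, t)) := by
    filter_upwards [hU.mem_nhds hx] with y hy using h y hy t
  simp only [spd, this.fderiv_eq]

/-- Locality of the time derivative. -/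
lemma tpd_congr {n : ℕ} {U : Set (Euc n)} {f g : Euc n × ℝ → ℝ}
    (h : ∀ x ∈ U, ∀ t, f (x, t) = g (x, t)) :
    ∀ x ∈ U, ∀ t, tpd f (x, t) = tpd g (x, t) := by
  intro x hx t
  simp only [tpd, funext (h x hx)]

/-! ### Potentials -/

lemma spd_param {n : ℕ} (F : (Euc n × ℝ) × ℝ → ℝ) (hF : ContDiff ℝ (⊤ : ℕ∞) F) (j : Fin n)
    (q : Euc n × ℝ) :
    spd j (fun q => ∫ s in (0:ℝ)..1, F (q, s)) q
      = ∫ s in (0:ℝ)..1, spd j (fun q => F (q, s)) q := by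
  rw [spd_eq (contDiff_param F hF), fderiv_param F hF]
  congr 1; funext s
  have hs : Sm (fun q : Euc n × ℝ => F (q, s)) := hF.comp (by fun_prop)
  rw [spd_eq hs]
  have h := HasFDerivAt.comp (f := fun x : Euc n × ℝ => (x, s)) q
    ((hF.differentiable (by simp)) (q, s)).hasFDerivAt (hasFDerivAt_prodMk_left q s)
  have h' : fderiv ℝ (fun q => F (q, s)) q = _ := h.fderiv
  rw [h']; simp

lemma sm_coord {n : ℕ} (k : Fin n) : Sm (fun q : Euc n × ℝ => q.1 k) := by
  have : (fun q : Euc n × ℝ => q.1 k) = fun q => EuclideanSpace.proj (𝕜 := ℝ) k q.1 := rfl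
  rw [this]; exact (EuclideanSpace.proj (𝕜 := ℝ) k).contDiff.comp contDiff_fst

lemma spd_coord {n : ℕ} (j k : Fin n) (q : Euc n × ℝ) :
    spd j (fun q : Euc n × ℝ => q.1 k) q = if k = j then 1 else 0 := by
  have : (fun y : Euc n => y k) = fun y => EuclideanSpace.proj (𝕜 := ℝ) k y := rfl
  simp only [spd]
  rw [this, ContinuousLinearMap.fderiv]
  simp

lemma sm_scale {n : ℕ} {f : Euc n × ℝ → ℝ} (hf : Sm f) (s : ℝ) :
    Sm (fun q : Euc n × ℝ => f (s • q.1, q.2)) := hf.comp (by fun_prop)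

lemma spd_scale {n : ℕ} {f : Euc n × ℝ → ℝ} (hf : Sm f) (s : ℝ) (j : Fin n) (q : Euc n × ℝ) :
    spd j (fun q : Euc n × ℝ => f (s • q.1, q.2)) q = s * spd j f (s • q.1, q.2) := by
  rw [spd_eq hf]
  have h0 : HasFDerivAt (fun y : Euc n => (s • y, q.2))
      ((s • ContinuousLinearMap.id ℝ (Euc n)).prod 0) q.1 :=
    ((hasFDerivAt_id q.1).const_smul s).prodMk (hasFDerivAt_const _ _)
  have h := HasFDerivAt.comp (f := fun y : Euc n => (s • y, q.2)) q.1
    (hf.diff (s • q.1, q.2)).hasFDerivAt h0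
  have h' : fderiv ℝ (fun y => f (s • y, q.2)) q.1 = _ := h.fderiv
  simp only [spd]
  rw [h', ← smul_eq_mul, ← map_smul]
  simp

lemma hasDerivAt_ray {n : ℕ} {f : Euc n × ℝ → ℝ} (hf : Sm f) (x : Euc n) (t s : ℝ) :
    HasDerivAt (fun s : ℝ => f (s • x, t)) (∑ j, x j * spd j f (s • x, t)) s := by
  have h0 : HasDerivAt (fun s : ℝ => (s • x, t)) ((1:ℝ) • x, (0:ℝ)) s :=
    ((hasDerivAt_id s).smul_const x).prodMk (hasDerivAt_const _ _)
  have h := HasFDerivAt.comp_hasDerivAt (f := fun s : ℝ => (s • x, t)) s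
    (hf.diff (s • x, t)).hasFDerivAt h0
  have hx : ((1:ℝ) • x, (0:ℝ)) = ∑ j, x j • (dirS j : Euc n × ℝ) := by
    refine Prod.ext ?_ ?_
    · rw [Prod.fst_sum]
      ext k
      simp [Pi.single_apply]
    · rw [Prod.snd_sum]; simp
  rw [hx, map_sum] at h
  simp only [map_smul, smul_eq_mul] at h
  simp only [spd_eq hf]
  exact h

/-- Poincaré lemma: divergence-free fields have skew potentials. -/
lemma exists_potential {n : ℕ} (hn : 2 ≤ n) (w : Fin n → Euc n × ℝ → ℝ) (hw : ∀ i, Sm (w i))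
    (hdiv : ∀ q, ∑ i, spd i (w i) q = 0) :
    ∃ A : Fin n → Fin n → Euc n × ℝ → ℝ, (∀ i j, Sm (A i j)) ∧
      (∀ i j q, A i j q = - A j i q) ∧ (∀ i q, ∑ j, spd j (A i j) q = w i q) := by
  obtain ⟨m, rfl⟩ : ∃ m, n = m + 2 := ⟨n - 2, by omega⟩
  set F : Fin (m+2) → Fin (m+2) → (Euc (m+2) × ℝ) × ℝ → ℝ := fun i j z =>
    z.2 ^ m * (w i (z.2 • z.1.1, z.1.2) * z.1.1 j - w j (z.2 • z.1.1, z.1.2) * z.1.1 i) with hFdef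
  have hFs : ∀ i j, ContDiff ℝ (⊤ : ℕ∞) (F i j) := by
    intro i j
    have hc : ∀ k, ContDiff ℝ (⊤ : ℕ∞) (fun z : (Euc (m+2) × ℝ) × ℝ => z.1.1 k) :=
      fun k => (sm_coord k).comp contDiff_fst
    have hsc : ∀ k, ContDiff ℝ (⊤ : ℕ∞)
        (fun z : (Euc (m+2) × ℝ) × ℝ => w k (z.2 • z.1.1, z.1.2)) :=
      fun k => (hw k).comp (by fun_prop)
    exact (contDiff_snd.pow m).mul (((hsc i).mul (hc j)).sub ((hsc j).mul (hc i)))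
  refine ⟨fun i j q => ∫ s in (0:ℝ)..1, F i j (q, s), fun i j => contDiff_param _ (hFs i j),
    fun i j q => ?_, fun i q => ?_⟩
  · rw [← intervalIntegral.integral_neg]
    refine intervalIntegral.integral_congr fun s _ => ?_
    simp only [hFdef]; ring
  · simp only [spd_param _ (hFs i _)]
    have key : ∀ s j, spd j (fun q => F i j (q, s)) q = s ^ m * (
        (w i (s • q.1, q.2) + q.1 j * (s * spd j (w i) (s • q.1, q.2)))
        - (w j (s • q.1, q.2) * (if i = j then 1 else 0)
          + q.1 i * (s * spd j (w j) (s • q.1, q.2)))) := by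
      intro s j
      simp only [hFdef]
      rw [spd_cmul (((sm_scale (hw i) s).mul (sm_coord j)).sub
        ((sm_scale (hw j) s).mul (sm_coord i))),
        spd_sub ((sm_scale (hw i) s).mul (sm_coord j)) ((sm_scale (hw j) s).mul (sm_coord i)),
        spd_mul (sm_scale (hw i) s) (sm_coord j), spd_mul (sm_scale (hw j) s) (sm_coord i)]
      simp only [spd_scale (hw _), spd_coord, if_true, mul_one]
    have hcont : ∀ j, Continuous (fun s => spd j (fun q => F i j (q, s)) q) := by
      intro j
      simp only [key]
      have h1 := (hw i).continuous
      have h2 := (hw j).continuous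
      have h3 := ((hw i).spd j).continuous
      have h4 := ((hw j).spd j).continuous
      fun_prop
    rw [← intervalIntegral.integral_finsetSum
      (fun j _ => (hcont j).intervalIntegrable _ _)]
    have hder : ∀ s ∈ Set.uIcc (0:ℝ) 1, HasDerivAt (fun s : ℝ => s ^ (m+1) * w i (s • q.1, q.2))
        (∑ j, spd j (fun q => F i j (q, s)) q) s := by
      intro s _
      have h := (hasDerivAt_pow (m+1) s).mul (hasDerivAt_ray (hw i) q.1 q.2 s)
      refine h.congr_deriv ?_
      simp only [key]
      rw [← Finset.mul_sum, Finset.sum_sub_distrib, Finset.sum_add_distrib, Finset.sum_add_distrib]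
      have e1 : ∑ j, q.1 i * (s * spd j (w j) (s • q.1, q.2)) = 0 := by
        rw [← Finset.mul_sum, ← Finset.mul_sum, hdiv]; simp
      have e2 : ∑ j, q.1 j * (s * spd j (w i) (s • q.1, q.2))
          = s * ∑ j, q.1 j * spd j (w i) (s • q.1, q.2) := by
        rw [Finset.mul_sum]; exact Finset.sum_congr rfl fun j _ => by ring
      rw [e1, e2]
      simp
      ring
    rw [intervalIntegral.integral_eq_sub_of_hasDerivAt hder]
    · simp
    · exact (continuous_finsetSum _ fun j _ => hcont j).intervalIntegrable _ _

/-- Smooth antiderivatives in time. -/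
lemma exists_time_primitive {n : ℕ} (f : Euc n × ℝ → ℝ) (hf : Sm f) :
    ∃ g : Euc n × ℝ → ℝ, Sm g ∧ ∀ q, tpd g q = f q := by
  have hF : ContDiff ℝ (⊤ : ℕ∞) (fun z : (Euc n × ℝ) × ℝ => f (z.1.1, z.2 * z.1.2)) :=
    hf.comp (by fun_prop)
  refine ⟨fun q => q.2 * ∫ s in (0:ℝ)..1, f (q.1, s * q.2),
    contDiff_snd.mul (contDiff_param _ hF), fun q => ?_⟩
  have : (fun t : ℝ => t * ∫ s in (0:ℝ)..1, f (q.1, s * t)) = fun t => ∫ s in (0:ℝ)..t, f (q.1, s) := by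
    funext t
    rw [intervalIntegral.mul_integral_comp_mul_right (f := fun s => f (q.1, s))]
    simp
  simp only [tpd]
  rw [this]
  have hc : Continuous fun s : ℝ => f (q.1, s) := hf.continuous.comp (by fun_prop)
  exact Continuous.deriv_integral _ hc 0 q.2

/-! ### Gluing for the linear system -/

lemma Sm.sum {n : ℕ} {ι : Type} {s : Finset ι} {f : ι → Euc n × ℝ → ℝ} (hf : ∀ k, Sm (f k)) :
    Sm (fun q => ∑ k ∈ s, f k q) := ContDiff.sum fun k _ => hf k

lemma Sm.cmul {n : ℕ} {f : Euc n × ℝ → ℝ} (hf : Sm f) (c : ℝ) : Sm (fun q => c * f q) :=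
  contDiff_const.mul hf

lemma spd_neg {n : ℕ} {f : Euc n × ℝ → ℝ} (hf : Sm f) (i : Fin n) :
    spd i (fun q => - f q) = fun q => - spd i f q := by
  have := spd_cmul hf (-1) i
  simpa using this

lemma tpd_neg {n : ℕ} {f : Euc n × ℝ → ℝ} (hf : Sm f) :
    tpd (fun q => - f q) = fun q => - tpd f q := by
  have := tpd_cmul hf (-1)
  simpa using this

lemma skew_double {n : ℕ} {S : Fin n → Fin n → Euc n × ℝ → ℝ} (hS : ∀ j k, Sm (S j k))
    (hskew : ∀ j k q, S j k q = - S k j q) (q : Euc n × ℝ) :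
    ∑ j, ∑ k, spd j (spd k (S j k)) q = 0 := by
  have h1 : ∑ j, ∑ k, spd j (spd k (S j k)) q = - ∑ j, ∑ k, spd j (spd k (S j k)) q := by
    conv_lhs => rw [Finset.sum_comm]
    rw [← Finset.sum_neg_distrib]
    refine Finset.sum_congr rfl fun j _ => ?_
    rw [← Finset.sum_neg_distrib]
    refine Finset.sum_congr rfl fun k _ => ?_
    have : S k j = fun q => - S j k q := funext (hskew k j)
    rw [this, spd_neg (hS j k), spd_neg ((hS j k).spd j), spd_comm (hS j k)]
  linarith

/-- Skew potential built from `A₀` and `D`. -/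
def Aop {n : ℕ} (A₀ : Fin n → Fin n → Euc n × ℝ → ℝ)
    (D : Fin n → Fin n → Fin n → Euc n × ℝ → ℝ) (i j : Fin n) (q : Euc n × ℝ) : ℝ :=
  A₀ i j q + (1/2) * ∑ k, spd k (fun q => D i j k q - D j i k q) q

/-- Symmetric stress built from `D`. -/
def Nop {n : ℕ} (D : Fin n → Fin n → Fin n → Euc n × ℝ → ℝ) (i j : Fin n) (q : Euc n × ℝ) : ℝ :=
  (-1/2) * ∑ k, spd k (tpd (fun q => D i j k q + D j i k q)) q

/-- Velocity built from `A₀` and `D`. -/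
def wop {n : ℕ} (A₀ : Fin n → Fin n → Euc n × ℝ → ℝ)
    (D : Fin n → Fin n → Fin n → Euc n × ℝ → ℝ) (i : Fin n) (q : Euc n × ℝ) : ℝ :=
  ∑ j, spd j (Aop A₀ D i j) q

section ops
variable {n : ℕ} {A₀ : Fin n → Fin n → Euc n × ℝ → ℝ} {D : Fin n → Fin n → Fin n → Euc n × ℝ → ℝ}

lemma sm_Aop (hA : ∀ i j, Sm (A₀ i j)) (hD : ∀ i j k, Sm (D i j k)) (i j : Fin n) :
    Sm (Aop A₀ D i j) :=
  (hA i j).add (Sm.cmul (Sm.sum fun k => Sm.spd ((hD i j k).sub (hD j i k)) k) _)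

lemma sm_Nop (hD : ∀ i j k, Sm (D i j k)) (i j : Fin n) : Sm (Nop D i j) :=
  Sm.cmul (Sm.sum fun k => Sm.spd (Sm.tpd ((hD i j k).add (hD j i k))) k) _

lemma sm_wop (hA : ∀ i j, Sm (A₀ i j)) (hD : ∀ i j k, Sm (D i j k)) (i : Fin n) :
    Sm (wop A₀ D i) := Sm.sum fun j => (sm_Aop hA hD i j).spd j

lemma Aop_skew (hD : ∀ i j k, Sm (D i j k)) (hAs : ∀ i j q, A₀ i j q = - A₀ j i q) (i j : Fin n)
    (q : Euc n × ℝ) : Aop A₀ D i j q = - Aop A₀ D j i q := by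
  simp only [Aop, spd_sub (hD _ _ _) (hD _ _ _), Finset.sum_sub_distrib]
  rw [hAs i j]; ring

lemma Nop_symm (i j : Fin n) (q : Euc n × ℝ) : Nop D i j q = Nop D j i q := by
  simp only [Nop]
  congr 1
  refine Finset.sum_congr rfl fun k _ => ?_
  congr 2; funext q; ring

lemma div_wop (hA : ∀ i j, Sm (A₀ i j)) (hD : ∀ i j k, Sm (D i j k))
    (hAs : ∀ i j q, A₀ i j q = - A₀ j i q) (q : Euc n × ℝ) :
    ∑ i, spd i (wop A₀ D i) q = 0 := by
  have : ∀ i, spd i (wop A₀ D i) q = ∑ j, spd i (spd j (Aop A₀ D i j)) q := by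
    intro i
    have := spd_sum (s := Finset.univ) (fun j => (sm_Aop hA hD i j).spd j) i
    exact congrFun this q
  simp only [this]
  exact skew_double (sm_Aop hA hD) (Aop_skew hD hAs) q

lemma tpd_Aop (hA : ∀ i j, Sm (A₀ i j)) (hD : ∀ i j k, Sm (D i j k)) (i j : Fin n) :
    tpd (Aop A₀ D i j) = fun q => tpd (A₀ i j) q +
      (1/2) * ∑ k, (spd k (tpd (D i j k)) q - spd k (tpd (D j i k)) q) := by
  have hs : ∀ k, Sm (fun q => D i j k q - D j i k q) := fun k => (hD i j k).sub (hD j i k)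
  have e : Aop A₀ D i j = fun q => A₀ i j q +
      (1/2) * ∑ k, spd k (fun q => D i j k q - D j i k q) q := rfl
  rw [e, tpd_add (hA i j) (Sm.cmul (Sm.sum fun k => (hs k).spd k) _),
    tpd_cmul (Sm.sum fun k => (hs k).spd k), tpd_sum fun k => (hs k).spd k]
  funext q
  beta_reduce
  congr 2
  refine Finset.sum_congr rfl fun k _ => ?_
  rw [tpd_spd (hs k), tpd_sub (hD i j k) (hD j i k), spd_sub (hD i j k).tpd (hD j i k).tpd]

lemma Nop_eq (hD : ∀ i j k, Sm (D i j k)) (i j : Fin n) :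
    Nop D i j = fun q =>
      (-1/2) * ∑ k, (spd k (tpd (D i j k)) q + spd k (tpd (D j i k)) q) := by
  funext q
  simp only [Nop, tpd_add (hD _ _ _) (hD _ _ _), spd_add (hD _ _ _).tpd (hD _ _ _).tpd]

lemma tpd_wop (hA : ∀ i j, Sm (A₀ i j)) (hD : ∀ i j k, Sm (D i j k))
    (hAt : ∀ i j q, tpd (A₀ i j) q = 0) (hDs : ∀ i j k q, D i j k q = - D i k j q)
    (i : Fin n) (q : Euc n × ℝ) :
    tpd (wop A₀ D i) q = ∑ j, spd j (Nop D i j) q := by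
  have hT : ∀ i j k, Sm (tpd (D i j k)) := fun i j k => (hD i j k).tpd
  have hTs : ∀ i j k q, tpd (D i j k) q = - tpd (D i k j) q := by
    intro i j k q
    have : D i j k = fun q => - D i k j q := funext (hDs i j k)
    rw [this, tpd_neg (hD i k j)]
  have e1 : tpd (wop A₀ D i) q = ∑ j, spd j (tpd (Aop A₀ D i j)) q := by
    have := tpd_sum (s := Finset.univ) (fun j => (sm_Aop hA hD i j).spd j)
    refine (congrFun this q).trans (Finset.sum_congr rfl fun j _ => ?_)
    rw [tpd_spd (sm_Aop hA hD i j)]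
  have e2 : ∀ j, spd j (tpd (Aop A₀ D i j)) q = (1/2) * ((∑ k, spd j (spd k (tpd (D i j k))) q)
      - ∑ k, spd j (spd k (tpd (D j i k))) q) := by
    intro j
    rw [tpd_Aop hA hD]
    simp only [hAt, zero_add]
    rw [spd_cmul (Sm.sum fun k => ((hT i j k).spd k).sub ((hT j i k).spd k)),
      spd_sum (fun k => ((hT i j k).spd k).sub ((hT j i k).spd k))]
    simp only [spd_sub ((hT i j _).spd _) ((hT j i _).spd _), Finset.sum_sub_distrib]
  have e3 : ∀ j, spd j (Nop D i j) q = (-1/2) * ((∑ k, spd j (spd k (tpd (D i j k))) q)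
      + ∑ k, spd j (spd k (tpd (D j i k))) q) := by
    intro j
    rw [Nop_eq hD]
    rw [spd_cmul (Sm.sum fun k => ((hT i j k).spd k).add ((hT j i k).spd k)),
      spd_sum (fun k => ((hT i j k).spd k).add ((hT j i k).spd k))]
    simp only [spd_add ((hT i j _).spd _) ((hT j i _).spd _), Finset.sum_add_distrib]
  have e4 := skew_double (S := fun j k => tpd (D i j k)) (fun j k => hT i j k) (hTs i) q
  rw [e1]
  simp only [e2, e3, ← Finset.mul_sum, Finset.sum_sub_distrib, Finset.sum_add_distrib, e4]
  ring

lemma Aop_congr {U : Set (Euc n)} (hU : IsOpen U) {A₁ : Fin n → Fin n → Euc n × ℝ → ℝ}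
    {D₁ : Fin n → Fin n → Fin n → Euc n × ℝ → ℝ}
    (hA : ∀ i j, ∀ x ∈ U, ∀ t, A₀ i j (x, t) = A₁ i j (x, t))
    (hD : ∀ i j k, ∀ x ∈ U, ∀ t, D i j k (x, t) = D₁ i j k (x, t)) (i j : Fin n) :
    ∀ x ∈ U, ∀ t, Aop A₀ D i j (x, t) = Aop A₁ D₁ i j (x, t) := by
  intro x hx t
  simp only [Aop]
  rw [hA i j x hx t]
  congr 2
  refine Finset.sum_congr rfl fun k _ => spd_congr hU (fun y hy s => ?_) k x hx t
  rw [hD i j k y hy, hD j i k y hy]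

lemma Nop_congr {U : Set (Euc n)} (hU : IsOpen U)
    {D₁ : Fin n → Fin n → Fin n → Euc n × ℝ → ℝ}
    (hD : ∀ i j k, ∀ x ∈ U, ∀ t, D i j k (x, t) = D₁ i j k (x, t)) (i j : Fin n) :
    ∀ x ∈ U, ∀ t, Nop D i j (x, t) = Nop D₁ i j (x, t) := by
  intro x hx t
  simp only [Nop]
  congr 1
  refine Finset.sum_congr rfl fun k _ =>
    spd_congr hU (tpd_congr fun y hy s => ?_) k x hx t
  rw [hD i j k y hy, hD j i k y hy]

end ops

lemma spd_zero_fun {n : ℕ} (i : Fin n) (q : Euc n × ℝ) : spd i (fun _ => (0:ℝ)) q = 0 := by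
  simp [spd]

lemma tpd_zero_fun {n : ℕ} : tpd (fun _ : Euc n × ℝ => (0:ℝ)) = fun _ => 0 := by
  funext q; simp [tpd]

lemma linear_glue {n : ℕ} (hn : 2 ≤ n) (w : Fin n → Euc n × ℝ → ℝ)
    (N : Fin n → Fin n → Euc n × ℝ → ℝ) (hw : ∀ i, Sm (w i)) (hN : ∀ i j, Sm (N i j))
    (hNs : ∀ i j q, N i j q = N j i q) (hdiv : ∀ q, ∑ i, spd i (w i) q = 0)
    (heq : ∀ i q, tpd (w i) q = ∑ j, spd j (N i j) q)
    (χ : Euc n × ℝ → ℝ) (hχ : Sm χ) (hχt : ∀ q, tpd χ q = 0) :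
    ∃ (A' : Fin n → Fin n → Euc n × ℝ → ℝ) (w' : Fin n → Euc n × ℝ → ℝ)
      (N' : Fin n → Fin n → Euc n × ℝ → ℝ),
      (∀ i j, Sm (A' i j)) ∧ (∀ i, Sm (w' i)) ∧ (∀ i j, Sm (N' i j)) ∧
      (∀ i j q, A' i j q = - A' j i q) ∧ (∀ i j q, N' i j q = N' j i q) ∧
      (∀ i q, w' i q = ∑ j, spd j (A' i j) q) ∧
      (∀ q, ∑ i, spd i (w' i) q = 0) ∧ (∀ i q, tpd (w' i) q = ∑ j, spd j (N' i j) q) ∧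
      (∀ U : Set (Euc n), IsOpen U → (∀ x ∈ U, ∀ t, χ (x, t) = 1) → ∀ x ∈ U, ∀ t,
        (∀ i, w' i (x, t) = w i (x, t)) ∧ (∀ i j, N' i j (x, t) = N i j (x, t))) ∧
      (∀ U : Set (Euc n), IsOpen U → (∀ x ∈ U, ∀ t, χ (x, t) = 0) → ∀ x ∈ U, ∀ t,
        (∀ i j, A' i j (x, t) = 0) ∧ (∀ i, w' i (x, t) = 0) ∧ (∀ i j, N' i j (x, t) = 0)) := by
  obtain ⟨A, hA, hAs, hAw⟩ := exists_potential hn w hw hdiv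
  have hAts : ∀ i j q, tpd (A i j) q = - tpd (A j i) q := by
    intro i j q
    have : A i j = fun q => - A j i q := funext (hAs i j)
    rw [this, tpd_neg (hA j i)]
  set G : Fin n → Fin n → Euc n × ℝ → ℝ := fun i j q => tpd (A i j) q - N i j q with hG
  have hGs : ∀ i j, Sm (G i j) := fun i j => (hA i j).tpd.sub (hN i j)
  have hGdiv : ∀ i q, ∑ j, spd j (G i j) q = 0 := by
    intro i q
    have e1 : ∀ j, spd j (G i j) q = tpd (spd j (A i j)) q - spd j (N i j) q := by
      intro j
      simp only [hG]
      rw [spd_sub (hA i j).tpd (hN i j), tpd_spd (hA i j)]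
    have e2 : w i = fun q => ∑ j, spd j (A i j) q := funext fun q => (hAw i q).symm
    have e3 := congrFun (tpd_sum (s := Finset.univ) (fun j => (hA i j).spd j)) q
    rw [← e2] at e3
    simp only [e1, Finset.sum_sub_distrib]
    rw [← e3, heq i q]; ring
  choose B hB hBs hBG using fun i => exists_potential hn (G i) (hGs i) (hGdiv i)
  choose C' hC' hC't using fun i j k => exists_time_primitive (B i j k) (hB i j k)
  set C : Fin n → Fin n → Fin n → Euc n × ℝ → ℝ :=
    fun i j k q => (1/2) * (C' i j k q - C' i k j q) with hCdef
  have hC : ∀ i j k, Sm (C i j k) := fun i j k => Sm.cmul ((hC' i j k).sub (hC' i k j)) _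
  have hCs : ∀ i j k q, C i j k q = - C i k j q := by
    intro i j k q; simp only [hCdef]; ring
  have hCt : ∀ i j k, tpd (C i j k) = B i j k := by
    intro i j k
    funext q
    simp only [hCdef]
    rw [tpd_cmul ((hC' i j k).sub (hC' i k j)), tpd_sub (hC' i j k) (hC' i k j)]
    simp only [hC't]
    rw [hBs i k j]; ring
  -- the time-independent part
  set A₀ : Fin n → Fin n → Euc n × ℝ → ℝ := fun i j q =>
    A i j q - Aop (fun _ _ _ => 0) C i j q with hA₀def
  have h0 : ∀ i j : Fin n, Sm ((fun _ _ _ => 0 : Fin n → Fin n → Euc n × ℝ → ℝ) i j) :=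
    fun i j => contDiff_const
  have hA₀ : ∀ i j, Sm (A₀ i j) := fun i j => (hA i j).sub (sm_Aop h0 hC i j)
  have hA₀s : ∀ i j q, A₀ i j q = - A₀ j i q := by
    intro i j q
    simp only [hA₀def]
    rw [hAs i j, Aop_skew hC (by simp) i j]; ring
  have hA₀t : ∀ i j q, tpd (A₀ i j) q = 0 := by
    intro i j q
    simp only [hA₀def]
    rw [tpd_sub (hA i j) (sm_Aop h0 hC i j)]
    simp only []
    rw [tpd_Aop h0 hC]
    simp only [hCt, Finset.sum_sub_distrib, hBG, hG, tpd_zero_fun]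
    rw [hAts j i, hNs j i]; ring
  have hAA : ∀ i j q, Aop A₀ C i j q = A i j q := by
    intro i j q
    simp only [Aop, hA₀def]; ring
  have hNN : ∀ i j q, Nop C i j q = N i j q := by
    intro i j q
    rw [Nop_eq hC]
    simp only [hCt, Finset.sum_add_distrib, hBG, hG]
    rw [hAts j i, hNs j i]; ring
  -- cut off
  set A₁ : Fin n → Fin n → Euc n × ℝ → ℝ := fun i j q => χ q * A₀ i j q with hA₁def
  set D : Fin n → Fin n → Fin n → Euc n × ℝ → ℝ := fun i j k q => χ q * C i j k q with hDdef
  have hA₁ : ∀ i j, Sm (A₁ i j) := fun i j => hχ.mul (hA₀ i j)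
  have hD : ∀ i j k, Sm (D i j k) := fun i j k => hχ.mul (hC i j k)
  have hA₁s : ∀ i j q, A₁ i j q = - A₁ j i q := by
    intro i j q; simp only [hA₁def]; rw [hA₀s i j]; ring
  have hDs : ∀ i j k q, D i j k q = - D i k j q := by
    intro i j k q; simp only [hDdef]; rw [hCs i j]; ring
  have hA₁t : ∀ i j q, tpd (A₁ i j) q = 0 := by
    intro i j q
    simp only [hA₁def]
    rw [tpd_mul hχ (hA₀ i j)]
    simp only [hA₀t, hχt]; ring
  refine ⟨Aop A₁ D, wop A₁ D, Nop D, sm_Aop hA₁ hD, sm_wop hA₁ hD, sm_Nop hD,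
    Aop_skew hD hA₁s, Nop_symm, fun i q => rfl, div_wop hA₁ hD hA₁s,
    tpd_wop hA₁ hD hA₁t hDs, ?_, ?_⟩
  · intro U hU h1
    have a1 : ∀ i j, ∀ x ∈ U, ∀ t, Aop A₁ D i j (x, t) = A i j (x, t) := by
      intro i j x hx t
      rw [← hAA i j]
      refine Aop_congr hU ?_ ?_ i j x hx t
      · intro i j x hx t; simp only [hA₁def, h1 x hx t, one_mul]
      · intro i j k x hx t; simp only [hDdef, h1 x hx t, one_mul]
    intro x hx t
    refine ⟨fun i => ?_, fun i j => ?_⟩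
    · rw [← hAw i]
      exact Finset.sum_congr rfl fun j _ => spd_congr hU (a1 i j) j x hx t
    · rw [← hNN i j]
      refine Nop_congr hU ?_ i j x hx t
      intro i j k x hx t; simp only [hDdef, h1 x hx t, one_mul]
  · intro U hU h1
    have a1 : ∀ i j, ∀ x ∈ U, ∀ t, Aop A₁ D i j (x, t) = 0 := by
      intro i j x hx t
      have : Aop (fun _ _ _ => 0) (fun _ _ _ _ => 0) i j (x, t) = 0 := by
        simp [Aop, spd_zero_fun]
      rw [← this]
      refine Aop_congr hU ?_ ?_ i j x hx t
      · intro i j x hx t; simp only [hA₁def, h1 x hx t, zero_mul]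
      · intro i j k x hx t; simp only [hDdef, h1 x hx t, zero_mul]
    intro x hx t
    refine ⟨fun i j => a1 i j x hx t, fun i => ?_, fun i j => ?_⟩
    · refine Finset.sum_eq_zero fun j _ => ?_
      rw [spd_congr hU (g := fun _ => 0) (a1 i j) j x hx t, spd_zero_fun]
    · have : Nop (fun _ _ _ _ => 0) i j (x, t) = 0 := by
        simp [Nop, spd_zero_fun, tpd_zero_fun]
      rw [← this]
      refine Nop_congr hU ?_ i j x hx t
      intro i j k x hx t; simp only [hDdef, h1 x hx t, zero_mul]

/-! ### The nonlinear problem -/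

lemma exists_cutoff {n : ℕ} (Ω₁ : Set (Euc n)) (hne : Ω₁.Nonempty) (r : ℝ) (hr : 0 < r) :
    ∃ (χ : Euc n × ℝ → ℝ) (U V : Set (Euc n)), Sm χ ∧ (∀ q, tpd χ q = 0) ∧ IsOpen U ∧ IsOpen V ∧
      closure Ω₁ ⊆ U ∧ {x | r ≤ Metric.infDist x Ω₁} ⊆ V ∧
      (∀ x ∈ U, ∀ t, χ (x, t) = 1) ∧ (∀ x ∈ V, ∀ t, χ (x, t) = 0) := by
  have hs : IsClosed {x | r ≤ Metric.infDist x Ω₁} :=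
    isClosed_le continuous_const (Metric.continuous_infDist_pt Ω₁)
  have hd : Disjoint {x | r ≤ Metric.infDist x Ω₁} (closure Ω₁) := by
    rw [Set.disjoint_left]
    intro x hx hx'
    rw [Metric.mem_closure_iff_infDist_zero hne] at hx'
    simp only [Set.mem_ofPred_eq, hx'] at hx
    linarith
  obtain ⟨f, hf0, hf1, -⟩ := exists_contMDiffMap_zero_one_nhds_of_isClosed
    (n := (⊤ : ℕ∞)) (modelWithCornersSelf ℝ (Euc n)) hs isClosed_closure hd
  rw [eventually_nhdsSet_iff_exists] at hf0 hf1
  obtain ⟨V, hV, hsV, hV0⟩ := hf0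
  obtain ⟨U, hU, hsU, hU1⟩ := hf1
  have hfs : ContDiff ℝ (⊤ : ℕ∞) f := f.contMDiff.contDiff
  refine ⟨fun q => f q.1, U, V, hfs.comp contDiff_fst, fun q => ?_, hU, hV, hsU, hsV,
    fun x hx _ => hU1 x hx, fun x hx _ => hV0 x hx⟩
  simp [tpd]

/-- The momentum flux `R - v ⊗ v - p Id`. -/
def flux {n : ℕ} (v : Euc n × ℝ → Fin n → ℝ) (p : Euc n × ℝ → ℝ)
    (R : Euc n × ℝ → Fin n → Fin n → ℝ) (i j : Fin n) (q : Euc n × ℝ) : ℝ :=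
  R q i j - v q i * v q j - (if i = j then 1 else 0) * p q

lemma sm_flux {n : ℕ} {v : Euc n × ℝ → Fin n → ℝ} {p : Euc n × ℝ → ℝ}
    {R : Euc n × ℝ → Fin n → Fin n → ℝ} (hv : ∀ i, Sm (fun q => v q i)) (hp : Sm p)
    (hR : ∀ i j, Sm (fun q => R q i j)) (i j : Fin n) : Sm (flux v p R i j) :=
  ((hR i j).sub ((hv i).mul (hv j))).sub (Sm.cmul hp _)

lemma div_flux {n : ℕ} {v : Euc n × ℝ → Fin n → ℝ} {p : Euc n × ℝ → ℝ}
    {R : Euc n × ℝ → Fin n → Fin n → ℝ} (hv : ∀ i, Sm (fun q => v q i)) (hp : Sm p)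
    (hR : ∀ i j, Sm (fun q => R q i j)) (hdiv : ∀ q, ∑ i, spd i (fun y => v y i) q = 0)
    (i : Fin n) (q : Euc n × ℝ) :
    ∑ j, spd j (flux v p R i j) q = ∑ j, spd j (fun y => R y i j) q
      - (∑ j, v q j * spd j (fun y => v y i) q) - spd i p q := by
  have e : ∀ j, spd j (flux v p R i j) q = spd j (fun y => R y i j) q
      - (v q i * spd j (fun y => v y j) q + v q j * spd j (fun y => v y i) q)
      - (if i = j then 1 else 0) * spd j p q := by
    intro j
    have e0 : flux v p R i j = fun q => R q i j - v q i * v q j - (if i = j then 1 else 0) * p q :=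
      rfl
    rw [e0, spd_sub ((hR i j).sub ((hv i).mul (hv j))) (Sm.cmul hp _),
      spd_sub (hR i j) ((hv i).mul (hv j)), spd_mul (hv i) (hv j), spd_cmul hp]
  simp only [e, Finset.sum_sub_distrib, Finset.sum_add_distrib, ← Finset.mul_sum, hdiv]
  simp

lemma comp_flux {n : ℕ} {v : Euc n × ℝ → Fin n → ℝ} {p : Euc n × ℝ → ℝ}
    {R : Euc n × ℝ → Fin n → Fin n → ℝ} (h : IsSubsolutionOn Set.univ v p R) :
    (∀ i, Sm (fun q => v q i)) ∧ Sm p ∧ (∀ i j, Sm (fun q => R q i j)) ∧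
    (∀ i j, Sm (flux v p R i j)) ∧ (∀ i j q, flux v p R i j q = flux v p R j i q) ∧
    (∀ q, ∑ i, spd i (fun y => v y i) q = 0) ∧
    (∀ i q, tpd (fun y => v y i) q = ∑ j, spd j (flux v p R i j) q) := by
  obtain ⟨hv, hp, hR, hs, -, heq, hdiv⟩ := h
  have hv' : ∀ i, Sm (fun q => v q i) := fun i => contDiff_pi.1 (contDiffOn_univ.1 hv) i
  have hp' : Sm p := contDiffOn_univ.1 hp
  have hR' : ∀ i j, Sm (fun q => R q i j) := fun i j =>
    contDiff_pi.1 (contDiff_pi.1 (contDiffOn_univ.1 hR) i) j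
  have hdiv' : ∀ q, ∑ i, spd i (fun y => v y i) q = 0 := fun q => hdiv q (Set.mem_univ q)
  refine ⟨hv', hp', hR', sm_flux hv' hp' hR', fun i j q => ?_, hdiv', fun i q => ?_⟩
  · simp only [flux, hs q (Set.mem_univ q) i j, eq_comm (a := i) (b := j)]
    ring
  · rw [div_flux hv' hp' hR' hdiv', ← heq q (Set.mem_univ q) i]; ring

/-- The pressure is determined by the flux. -/
lemma pressure_eq {n : ℕ} (hn : 2 ≤ n) {v : Euc n × ℝ → Fin n → ℝ} {p : Euc n × ℝ → ℝ}
    {R : Euc n × ℝ → Fin n → Fin n → ℝ} (h : IsSubsolutionOn Set.univ v p R) (q : Euc n × ℝ) :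
    p q = -(1 / (n:ℝ)) * ∑ i, (flux v p R i i q + v q i * v q i) := by
  have htr := h.2.2.2.2.1 q (Set.mem_univ q)
  have hn0 : (n:ℝ) ≠ 0 := by positivity
  simp only [flux, if_true, one_mul]
  have : ∑ i, (R q i i - v q i * v q i - p q + v q i * v q i) = - (n * p q) := by
    have e : ∀ i, R q i i - v q i * v q i - p q + v q i * v q i = R q i i - p q := fun i => by ring
    simp only [e, Finset.sum_sub_distrib, htr]
    simp
  rw [this]
  field_simp

/-- Gluing of subsolutions: given subsolutions
`(v₁,p₁,R̊₁)` and `(v₂,p₂,R̊₂)` on `ℝⁿ × ℝ`, a bounded nonempty open set `Ω₁`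
and `r > 0`, there is a subsolution agreeing with the first one on `closure Ω₁`
and with the second one where `dist(x,Ω₁) ≥ r`; moreover, if both velocities
have smooth skew-symmetric matrix potentials, so does the glued velocity, with
potential agreeing with `A₂` where `dist(x,Ω₁) ≥ r`. -/
theorem gluing_of_subsolutions
    (n : ℕ) (hn : 2 ≤ n) (Ω₁ : Set (Euc n)) (hne : Ω₁.Nonempty)
    (hΩ₁open : IsOpen Ω₁) (hΩ₁bdd : Bornology.IsBounded Ω₁)
    (r : ℝ) (hr : 0 < r)
    (v₁ v₂ : Euc n × ℝ → Fin n → ℝ) (p₁ p₂ : Euc n × ℝ → ℝ)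
    (R₁ R₂ : Euc n × ℝ → Fin n → Fin n → ℝ)
    (h₁ : IsSubsolutionOn (Set.univ : Set (Euc n × ℝ)) v₁ p₁ R₁)
    (h₂ : IsSubsolutionOn (Set.univ : Set (Euc n × ℝ)) v₂ p₂ R₂) :
    ∃ (v : Euc n × ℝ → Fin n → ℝ) (p : Euc n × ℝ → ℝ)
      (R : Euc n × ℝ → Fin n → Fin n → ℝ),
      IsSubsolutionOn (Set.univ : Set (Euc n × ℝ)) v p R ∧
      (∀ x ∈ closure Ω₁, ∀ t : ℝ,
        v (x, t) = v₁ (x, t) ∧ p (x, t) = p₁ (x, t) ∧ R (x, t) = R₁ (x, t)) ∧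
      (∀ x : Euc n, r ≤ Metric.infDist x Ω₁ → ∀ t : ℝ,
        v (x, t) = v₂ (x, t) ∧ p (x, t) = p₂ (x, t) ∧ R (x, t) = R₂ (x, t)) ∧
      (∀ A₁ A₂ : Euc n × ℝ → Fin n → Fin n → ℝ,
        ContDiff ℝ (⊤ : ℕ∞) A₁ → ContDiff ℝ (⊤ : ℕ∞) A₂ →
        (∀ q i j, A₁ q i j = - A₁ q j i) → (∀ q i j, A₂ q i j = - A₂ q j i) →
        (∀ q i, v₁ q i = ∑ j, spd j (fun y => A₁ y i j) q) →
        (∀ q i, v₂ q i = ∑ j, spd j (fun y => A₂ y i j) q) →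
        ∃ A : Euc n × ℝ → Fin n → Fin n → ℝ, ContDiff ℝ (⊤ : ℕ∞) A ∧
          (∀ q i j, A q i j = - A q j i) ∧
          (∀ q i, v q i = ∑ j, spd j (fun y => A y i j) q) ∧
          (∀ x : Euc n, r ≤ Metric.infDist x Ω₁ → ∀ t : ℝ, A (x, t) = A₂ (x, t))) := by
  obtain ⟨χ, U, V, hχ, hχt, hU, hV, hΩU, hΩV, hU1, hV0⟩ := exists_cutoff Ω₁ hne r hr
  obtain ⟨sv₁, sp₁, sR₁, sM₁, yM₁, dv₁, em₁⟩ := comp_flux h₁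
  obtain ⟨sv₂, sp₂, sR₂, sM₂, yM₂, dv₂, em₂⟩ := comp_flux h₂
  obtain ⟨A', w', N', sA, sw, sN, yA, yN, hwA, dw, ew, hone, hzero⟩ :=
    linear_glue hn (fun i q => v₁ q i - v₂ q i)
      (fun i j q => flux v₁ p₁ R₁ i j q - flux v₂ p₂ R₂ i j q)
      (fun i => (sv₁ i).sub (sv₂ i)) (fun i j => (sM₁ i j).sub (sM₂ i j))
      (fun i j q => by rw [yM₁ i j, yM₂ i j])
      (fun q => by
        simp only [spd_sub (sv₁ _) (sv₂ _), Finset.sum_sub_distrib, dv₁, dv₂, sub_self])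
      (fun i q => by
        rw [tpd_sub (sv₁ _) (sv₂ _)]
        simp only [spd_sub (sM₁ _ _) (sM₂ _ _), Finset.sum_sub_distrib, em₁, em₂])
      χ hχ hχt
  have hn0 : (n:ℝ) ≠ 0 := by positivity
  -- glued velocity, flux, pressure, stress
  set v : Euc n × ℝ → Fin n → ℝ := fun q i => v₂ q i + w' i q with hv
  set M : Fin n → Fin n → Euc n × ℝ → ℝ := fun i j q => flux v₂ p₂ R₂ i j q + N' i j q with hM
  set p : Euc n × ℝ → ℝ := fun q => -(1 / (n:ℝ)) * ∑ i, (M i i q + v q i * v q i) with hp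
  set R : Euc n × ℝ → Fin n → Fin n → ℝ := fun q i j =>
    M i j q + v q i * v q j + (if i = j then 1 else 0) * p q with hR
  have sv : ∀ i, Sm (fun q => v q i) := fun i => (sv₂ i).add (sw i)
  have sM : ∀ i j, Sm (M i j) := fun i j => (sM₂ i j).add (sN i j)
  have sp : Sm p := Sm.cmul (Sm.sum fun i => (sM i i).add ((sv i).mul (sv i))) _
  have sR : ∀ i j, Sm (fun q => R q i j) := fun i j =>
    ((sM i j).add ((sv i).mul (sv j))).add (Sm.cmul sp _)
  have dv : ∀ q, ∑ i, spd i (fun y => v y i) q = 0 := by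
    intro q
    simp only [hv, spd_add (sv₂ _) (sw _), Finset.sum_add_distrib, dv₂, dw, add_zero]
  have hflux : ∀ i j, flux v p R i j = M i j := by
    intro i j; funext q; simp only [flux, hR]; ring
  have em : ∀ i q, tpd (fun y => v y i) q = ∑ j, spd j (M i j) q := by
    intro i q
    simp only [hv, hM]
    rw [tpd_add (sv₂ i) (sw i)]
    simp only [spd_add (sM₂ _ _) (sN _ _), Finset.sum_add_distrib, em₂, ew]
  have recover : ∀ (v' : Euc n × ℝ → Fin n → ℝ) (p' : Euc n × ℝ → ℝ)
      (R' : Euc n × ℝ → Fin n → Fin n → ℝ), IsSubsolutionOn Set.univ v' p' R' →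
      ∀ q, (∀ i, v q i = v' q i) → (∀ i j, M i j q = flux v' p' R' i j q) →
      v q = v' q ∧ p q = p' q ∧ R q = R' q := by
    intro v' p' R' h' q hv' hM'
    have e2 : p q = p' q := by
      rw [pressure_eq hn h' q]
      simp only [hp, hv', hM']
    refine ⟨funext hv', e2, ?_⟩
    funext i j
    simp only [hR]
    rw [e2, hv', hv', hM']
    simp only [flux]; ring
  refine ⟨v, p, R, ⟨?_, ?_, ?_, ?_, ?_, ?_, ?_⟩, ?_, ?_, ?_⟩
  · exact contDiffOn_univ.2 (contDiff_pi.2 sv)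
  · exact contDiffOn_univ.2 sp
  · exact contDiffOn_univ.2 (contDiff_pi.2 fun i => contDiff_pi.2 fun j => sR i j)
  · intro q _ i j
    simp only [hR, hM]
    rw [yM₂ i j, yN i j]
    simp only [eq_comm (a := i) (b := j)]; ring
  · intro q _
    simp only [hR, if_true, one_mul]
    rw [Finset.sum_add_distrib]
    simp only [Finset.sum_const, Finset.card_univ, Fintype.card_fin, nsmul_eq_mul]
    simp only [hp]
    field_simp
    ring
  · intro q _ i
    have := div_flux sv sp sR dv i q
    simp only [hflux] at this
    rw [em, this]; ring
  · intro q _; exact dv q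
  · intro x hx t
    obtain ⟨a, b⟩ := hone U hU hU1 x (hΩU hx) t
    refine recover v₁ p₁ R₁ h₁ (x, t) (fun i => ?_) (fun i j => ?_)
    · simp only [hv, a]; ring
    · simp only [hM, b]; ring
  · intro x hx t
    obtain ⟨-, a, b⟩ := hzero V hV hV0 x (hΩV hx) t
    refine recover v₂ p₂ R₂ h₂ (x, t) (fun i => ?_) (fun i j => ?_)
    · simp only [hv, a]; ring
    · simp only [hM, b]; ring
  · intro A₁ A₂ _ sA₂ _ yA₂ _ hvA₂
    have sA₂' : ∀ i j, Sm (fun q => A₂ q i j) := fun i j => contDiff_pi.1 (contDiff_pi.1 sA₂ i) j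
    refine ⟨fun q i j => A₂ q i j + A' i j q, ?_, ?_, ?_, ?_⟩
    · exact contDiff_pi.2 fun i => contDiff_pi.2 fun j => (sA₂' i j).add (sA i j)
    · intro q i j
      simp only []
      rw [yA₂ q i j, yA i j]; ring
    · intro q i
      simp only [spd_add (sA₂' _ _) (sA _ _), Finset.sum_add_distrib]
      simp only [hv]
      rw [hvA₂, hwA]
    · intro x hx t
      obtain ⟨a, -, -⟩ := hzero V hV hV0 x (hΩV hx) t
      funext i j
      simp only [a, add_zero]
end
end

section
/- Let n ≥ 2, let Ω ⊂ ℝⁿ be a nonempty bounded open set, let r > 0, and let L_{ij} : ℝ → ℝ be smooth functions for 1 ≤ i < j ≤ n. Then there exists a smooth map w : ℝⁿ × ℝ → ℝⁿ such that: (a) div w(·,t) = 0 for every t; (b) the support of w(·,t) is contained in {x ∈ ℝⁿ : 0 < dist(x,Ω) < r} for every t; (c) ∫_{ℝⁿ} a · w(x,t) dx = 0 for every constant vector a ∈ ℝⁿ and every t; and (d) ∫_{ℝⁿ} (x_i w_j(x,t) − x_j w_i(x,t)) dx = L_{ij}(t) for all 1 ≤ i < j ≤ n and every t. -/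
noncomputable section
open MeasureTheory

theorem aux_bump (n : ℕ) (S : Set (Euc n)) (hS : IsOpen S) (hSn : S.Nonempty) :
    ∃ φ : Euc n → ℝ, ContDiff ℝ (⊤ : ℕ∞) φ ∧ HasCompactSupport φ ∧ tsupport φ ⊆ S ∧
      ∫ x, φ x = 1 := by
  obtain ⟨c, hc⟩ := hSn
  obtain ⟨ε, hε, hb⟩ := Metric.isOpen_iff.1 hS c hc
  let f : ContDiffBump c := ⟨ε/4, ε/2, by positivity, by linarith⟩
  refine ⟨f.normed volume, f.contDiff_normed, f.hasCompactSupport_normed, ?_, f.integral_normed⟩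
  rw [f.tsupport_normed_eq]
  exact (Metric.closedBall_subset_ball (by change ε/2 < ε; linarith)).trans hb

theorem aux_shell (n : ℕ) (hn : 2 ≤ n) (Ω : Set (Euc n)) (hne : Ω.Nonempty)
    (hΩbdd : Bornology.IsBounded Ω) (r : ℝ) (hr : 0 < r) :
    {x : Euc n | 0 < Metric.infDist x Ω ∧ Metric.infDist x Ω < r}.Nonempty := by
  obtain ⟨a, ha⟩ := hne
  obtain ⟨C, hC⟩ := (Metric.isBounded_iff_subset_closedBall a).1 hΩbdd
  let e : Euc n := EuclideanSpace.single ⟨0, by omega⟩ 1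
  have hnorm : ‖e‖ = 1 := by simp [e]
  have hC0 : 0 ≤ C := by simpa using hC ha
  let b : Euc n := a + (C + r) • e
  have hb : r ≤ Metric.infDist b Ω := by
    refine (Metric.le_infDist ⟨a, ha⟩).2 ?_
    intro y hy
    have h1 : dist y a ≤ C := hC hy
    have h2 : dist b a = C + r := by
      simp [b, dist_eq_norm, norm_smul, hnorm]
      linarith
    have := dist_triangle b y a
    linarith
  have hcont : Continuous fun x : Euc n => Metric.infDist x Ω := Metric.continuous_infDist_pt Ω
  obtain ⟨x, hx⟩ := mem_range_of_exists_le_of_exists_ge (c := r/2) hcont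
    ⟨a, by rw [Metric.infDist_zero_of_mem ha]; positivity⟩ ⟨b, by linarith⟩
  exact ⟨x, by constructor <;> simp only [hx] <;> linarith⟩

/-- Directional derivative along the `i`-th basis vector. -/
def dd {n : ℕ} (i : Fin n) (φ : Euc n → ℝ) (x : Euc n) : ℝ :=
  fderiv ℝ φ x (EuclideanSpace.single i 1)

theorem dd_smooth {n : ℕ} (i : Fin n) (φ : Euc n → ℝ) (h : ContDiff ℝ (⊤ : ℕ∞) φ) :
    ContDiff ℝ (⊤ : ℕ∞) (dd i φ) := by
  unfold dd
  exact (h.fderiv_right (m := (⊤ : ℕ∞)) (by simp)).clm_apply contDiff_const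

theorem dd_supp {n : ℕ} (i : Fin n) (φ : Euc n → ℝ) (x : Euc n) (hx : x ∉ tsupport φ) :
    dd i φ x = 0 := by
  have : fderiv ℝ φ x = 0 := by
    by_contra h
    exact hx (support_fderiv_subset ℝ h)
  simp [dd, this]

theorem dd_cpt {n : ℕ} (i : Fin n) (φ : Euc n → ℝ) (h : HasCompactSupport φ) :
    HasCompactSupport (dd i φ) :=
  HasCompactSupport.intro h (fun x hx => dd_supp i φ x hx)

theorem dd_symm {n : ℕ} (i j : Fin n) (φ : Euc n → ℝ) (h : ContDiff ℝ (⊤ : ℕ∞) φ) (x : Euc n) :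
    dd i (dd j φ) x = dd j (dd i φ) x := by
  have hs : IsSymmSndFDerivAt ℝ φ x :=
    h.contDiffAt.isSymmSndFDerivAt (by simp; exact WithTop.coe_le_coe.2 (le_top : (2 : ℕ∞) ≤ ⊤))
  have hd : DifferentiableAt ℝ (fderiv ℝ φ) x :=
    ((h.fderiv_right (m := (⊤ : ℕ∞)) (by simp)).differentiable (by simp)) x
  have key : ∀ i j : Fin n, dd i (dd j φ) x =
      fderiv ℝ (fderiv ℝ φ) x (EuclideanSpace.single i 1) (EuclideanSpace.single j 1) := by
    intro i j
    unfold dd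
    rw [fderiv_clm_apply hd (differentiableAt_const _)]
    simp
  rw [key, key]
  exact hs _ _

theorem dd_int_coord {n : ℕ} (i k : Fin n) (φ : Euc n → ℝ) (h : ContDiff ℝ (⊤ : ℕ∞) φ)
    (hc : HasCompactSupport φ) (h1 : ∫ x, φ x = 1) :
    ∫ x : Euc n, x k * dd i φ x = if k = i then -1 else 0 := by
  have hcd : Continuous (dd i φ) := (dd_smooth i φ h).continuous
  have hf : ∀ x : Euc n, HasFDerivAt (fun x : Euc n => x k)
      (EuclideanSpace.proj k : Euc n →L[ℝ] ℝ) x :=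
    fun x => (EuclideanSpace.proj k : Euc n →L[ℝ] ℝ).hasFDerivAt
  have := integral_mul_fderiv_eq_neg_fderiv_mul_of_integrable (𝕜 := ℝ) (μ := (volume : Measure (Euc n)))
    (f := fun x : Euc n => x k) (g := φ) (v := EuclideanSpace.single i 1)
    ?_ ?_ ?_ (fun x _ => (hf x).differentiableAt) (fun x _ => h.differentiable (by simp) x)
  · unfold dd
    rw [this]
    simp only [(hf _).fderiv]
    split_ifs with hk
    · subst hk; simp [h1]
    · simp [hk]
  · simp only [(hf _).fderiv]
    exact (h.continuous.integrable_of_hasCompactSupport hc).const_mul _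
  · exact Continuous.integrable_of_hasCompactSupport
      (((EuclideanSpace.proj k : Euc n →L[ℝ] ℝ).continuous).mul hcd) (dd_cpt i φ hc).mul_left
  · exact Continuous.integrable_of_hasCompactSupport
      (((EuclideanSpace.proj k : Euc n →L[ℝ] ℝ).continuous).mul h.continuous) hc.mul_left

theorem dd_int {n : ℕ} (i : Fin n) (φ : Euc n → ℝ) (h : ContDiff ℝ (⊤ : ℕ∞) φ)
    (hc : HasCompactSupport φ) : ∫ x : Euc n, dd i φ x = 0 := by
  have hcd : Continuous (dd i φ) := (dd_smooth i φ h).continuous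
  have := integral_mul_fderiv_eq_neg_fderiv_mul_of_integrable (𝕜 := ℝ) (μ := (volume : Measure (Euc n)))
    (f := fun x : Euc n => (1:ℝ)) (g := φ) (v := EuclideanSpace.single i 1)
    (by simp) (by simpa [dd] using! hcd.integrable_of_hasCompactSupport (dd_cpt i φ hc))
    (by simpa using h.continuous.integrable_of_hasCompactSupport hc)
    (fun x _ => differentiableAt_const _) (fun x _ => h.differentiable (by simp) x)
  simpa [dd] using this

/-- Prescribing the angular momentum: there is a smooth
divergence-free field `w`, supported at each time in the shell
`{0 < dist(x,Ω) < r}`, orthogonal to all constant fields, and with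
`∫ (xᵢ wⱼ - xⱼ wᵢ) = L_{ij}(t)` for all `i < j`. -/
theorem prescribing_angular_momentum
    (n : ℕ) (hn : 2 ≤ n) (Ω : Set (Euc n)) (hne : Ω.Nonempty)
    (hΩopen : IsOpen Ω) (hΩbdd : Bornology.IsBounded Ω)
    (r : ℝ) (hr : 0 < r)
    (L : Fin n → Fin n → ℝ → ℝ) (hL : ∀ i j, ContDiff ℝ (⊤ : ℕ∞) (L i j)) :
    ∃ w : Euc n × ℝ → Fin n → ℝ, ContDiff ℝ (⊤ : ℕ∞) w ∧
      (∀ q : Euc n × ℝ, ∑ i, spd i (fun y => w y i) q = 0) ∧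
      (∀ t : ℝ, Function.support (fun x => w (x, t)) ⊆
        {x : Euc n | 0 < Metric.infDist x Ω ∧ Metric.infDist x Ω < r}) ∧
      (∀ t : ℝ, ∀ a : Fin n → ℝ, ∫ x : Euc n, ∑ i, a i * w (x, t) i = 0) ∧
      (∀ t : ℝ, ∀ i j : Fin n, i < j →
        ∫ x : Euc n, (x i * w (x, t) j - x j * w (x, t) i) = L i j t) := by
  obtain ⟨φ, hφ, hφc, hφs, hφ1⟩ := aux_bump n
    {x : Euc n | 0 < Metric.infDist x Ω ∧ Metric.infDist x Ω < r}
    ((isOpen_lt continuous_const (Metric.continuous_infDist_pt Ω)).inter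
      (isOpen_lt (Metric.continuous_infDist_pt Ω) continuous_const))
    (aux_shell n hn Ω hne hΩbdd r hr)
  obtain ⟨A, hA, hAa, hAL⟩ : ∃ A : Fin n → Fin n → ℝ → ℝ,
      (∀ i j, ContDiff ℝ (⊤ : ℕ∞) (A i j)) ∧ (∀ i j t, A i j t = - A j i t) ∧
      (∀ i j, i < j → ∀ t, A i j t = - (1/2) * L i j t) := by
    refine ⟨fun i j t => -(1/2) * (if i < j then L i j t else if j < i then - L j i t else 0),
      ?_, ?_, ?_⟩
    · intro i j
      beta_reduce
      split_ifs
      · exact contDiff_const.mul (hL i j)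
      · exact contDiff_const.mul (hL j i).neg
      · exact contDiff_const
    · intro i j t
      rcases lt_trichotomy i j with h | h | h
      · simp [h, h.not_gt]
      · simp [h]
      · simp [h, h.not_gt]
    · intro i j h t
      simp [h]
  have hD := fun i => dd_smooth i φ hφ
  have hDi : ∀ i, Integrable (dd i φ) := fun i =>
    (hD i).continuous.integrable_of_hasCompactSupport (dd_cpt i φ hφc)
  have hxDi : ∀ k i, Integrable (fun x : Euc n => x k * dd i φ x) := fun k i =>
    Continuous.integrable_of_hasCompactSupport
      (((EuclideanSpace.proj k : Euc n →L[ℝ] ℝ).continuous).mul (hD i).continuous)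
      (dd_cpt i φ hφc).mul_left
  refine ⟨fun q j => ∑ i, A i j q.2 * dd i φ q.1, ?_, ?_, ?_, ?_, ?_⟩
  · rw [contDiff_pi]
    intro j
    exact ContDiff.sum fun i _ =>
      ((hA i j).comp contDiff_snd).mul ((hD i).comp contDiff_fst)
  · intro q
    have h1 : ∀ j, spd j (fun y : Euc n × ℝ => ∑ i, A i j y.2 * dd i φ y.1) q
        = ∑ i, A i j q.2 * dd j (dd i φ) q.1 := by
      intro j
      unfold spd
      have hd : ∀ i, HasFDerivAt (fun y => A i j q.2 * dd i φ y)
          (A i j q.2 • fderiv ℝ (dd i φ) q.1) q.1 := fun i =>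
        (((hD i).differentiable (by simp)) q.1).hasFDerivAt.const_mul _
      have := HasFDerivAt.fun_sum (u := Finset.univ) (fun i _ => hd i)
      rw [this.fderiv]
      simp [dd]
    simp only [h1]
    have h2 : ∑ j, ∑ i, A i j q.2 * dd j (dd i φ) q.1
        = - ∑ j, ∑ i, A i j q.2 * dd j (dd i φ) q.1 := by
      conv_lhs => rw [Finset.sum_comm]
      rw [← Finset.sum_neg_distrib]
      refine Finset.sum_congr rfl fun i _ => ?_
      rw [← Finset.sum_neg_distrib]
      refine Finset.sum_congr rfl fun j _ => ?_
      rw [hAa, dd_symm j i φ hφ]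
      ring
    linarith
  · intro t x hx
    apply hφs
    by_contra hxs
    apply hx
    funext j
    simp [dd_supp _ φ x hxs]
  · intro t a
    beta_reduce
    dsimp only
    rw [integral_finsetSum]
    · refine Finset.sum_eq_zero fun j _ => ?_
      rw [integral_const_mul, integral_finsetSum]
      · simp [integral_const_mul, dd_int _ φ hφ hφc]
      · exact fun i _ => (hDi i).const_mul _
    · exact fun j _ => (integrable_finsetSum _ fun i _ => (hDi i).const_mul _).const_mul _
  · intro t k l hkl
    have hint : ∀ k l, Integrable (fun x : Euc n => x k * ∑ i, A i l t * dd i φ x) := by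
      intro k l
      have := integrable_finsetSum (μ := (volume : Measure (Euc n))) Finset.univ
        (fun i _ => (hxDi k i).const_mul (A i l t))
      refine this.congr (Filter.Eventually.of_forall fun x => ?_)
      simp only [Finset.mul_sum]
      exact Finset.sum_congr rfl fun i _ => by ring
    have hval : ∀ k l, ∫ x : Euc n, x k * ∑ i, A i l t * dd i φ x = - A k l t := by
      intro k l
      have : ∀ x : Euc n, x k * ∑ i, A i l t * dd i φ x = ∑ i, A i l t * (x k * dd i φ x) := by
        intro x
        rw [Finset.mul_sum]
        exact Finset.sum_congr rfl fun i _ => by ring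
      simp only [this]
      rw [integral_finsetSum _ (fun i _ => (hxDi k i).const_mul _)]
      simp [integral_const_mul, dd_int_coord _ _ φ hφ hφc hφ1]
    rw [integral_sub (hint k l) (hint l k), hval, hval, hAa l k, hAL k l hkl]
    ring
end
end
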